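/- Let f : [0,∞) × [0,1] → ℝ be continuous and let u be a classical solution of the bridge equation with forcing term f. Then the functional Υ(t) = ⟨u(t,·), ∂ₜu(t,·)⟩ satisfies, for every t > 0, the differential inequality Υ'(t) + Υ(t) + ½E(t) ≤ (3/2)‖∂ₜu(t,·)‖² + (1/(2π⁴))‖f(t,·)‖² + ½p². -/

import Mathlib

open Real MeasureTheory

noncomputable section

/-- The `L²(0,1)` inner product `⟨u,v⟩`. -/
def ipL2 (u v : ℝ → ℝ) : ℝ := ∫ x in (0:ℝ)..1, u x * v x

/-- The squared `L²(0,1)` norm `‖u‖²`. -/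
def nsqL2 (u : ℝ → ℝ) : ℝ := ∫ x in (0:ℝ)..1, (u x) ^ 2

/-- Partial derivative in time. -/
def Dt (u : ℝ → ℝ → ℝ) : ℝ → ℝ → ℝ := fun t x => deriv (fun s => u s x) t

/-- Partial derivative in space. -/
def Dx (u : ℝ → ℝ → ℝ) : ℝ → ℝ → ℝ := fun t x => deriv (fun y => u t y) x

/-- A classical solution of the suspension-bridge equation
`∂ₜₜu + ∂ₓₓₓₓu + (p − ‖∂ₓu‖²)∂ₓₓu + ∂ₜu + k²u⁺ = f` on `[0,∞) × [0,1]`,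
smooth up to the boundary, with pinned boundary conditions. -/
def IsClassicalSolution (p k : ℝ) (f u : ℝ → ℝ → ℝ) : Prop :=
  ContDiff ℝ (⊤ : ℕ∞) (Function.uncurry u) ∧
  (∀ t ≥ (0:ℝ), ∀ x ∈ Set.Icc (0:ℝ) 1,
    Dt (Dt u) t x + Dx (Dx (Dx (Dx u))) t x
      + (p - nsqL2 (Dx u t)) * Dx (Dx u) t x
      + Dt u t x + k ^ 2 * max (u t x) 0 = f t x) ∧
  (∀ t ≥ (0:ℝ), u t 0 = 0 ∧ u t 1 = 0 ∧ Dx (Dx u) t 0 = 0 ∧ Dx (Dx u) t 1 = 0)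

/-- The energy `E(t) = ‖∂ₜu‖² + ‖∂ₓₓu‖² + ½(‖∂ₓu‖² − p)² + k²‖u⁺‖²`. -/
def energy (p k : ℝ) (u : ℝ → ℝ → ℝ) (t : ℝ) : ℝ :=
  nsqL2 (Dt u t) + nsqL2 (Dx (Dx u) t)
    + (1 / 2) * (nsqL2 (Dx u t) - p) ^ 2 + k ^ 2 * nsqL2 (fun x => max (u t x) 0)

/-- The reduced energy `𝓔(t) = ‖∂ₜu‖² + ‖∂ₓₓu‖²`. -/
def redEnergy (u : ℝ → ℝ → ℝ) (t : ℝ) : ℝ :=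
  nsqL2 (Dt u t) + nsqL2 (Dx (Dx u) t)

/-! ### Regularity of the partial derivatives -/

theorem hasDerivAt_Dt {u : ℝ → ℝ → ℝ} (hu : ContDiff ℝ (⊤ : ℕ∞) (Function.uncurry u)) (t x : ℝ) :
    HasDerivAt (fun s => u s x) (Dt u t x) t := by
  have h : DifferentiableAt ℝ (fun s => Function.uncurry u (s, x)) t :=
    DifferentiableAt.comp (g := Function.uncurry u) t ((hu.differentiable (by simp)) (t, x))
      (by fun_prop : DifferentiableAt ℝ (fun s : ℝ => (s, x)) t)
  exact h.hasDerivAt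

theorem hasDerivAt_Dx {u : ℝ → ℝ → ℝ} (hu : ContDiff ℝ (⊤ : ℕ∞) (Function.uncurry u)) (t x : ℝ) :
    HasDerivAt (u t) (Dx u t x) x := by
  have h : DifferentiableAt ℝ (fun y => Function.uncurry u (t, y)) x :=
    DifferentiableAt.comp (g := Function.uncurry u) x ((hu.differentiable (by simp)) (t, x))
      (by fun_prop : DifferentiableAt ℝ (fun y : ℝ => (t, y)) x)
  exact h.hasDerivAt

theorem contDiff_Dt {u : ℝ → ℝ → ℝ} (hu : ContDiff ℝ (⊤ : ℕ∞) (Function.uncurry u)) :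
    ContDiff ℝ (⊤ : ℕ∞) (Function.uncurry (Dt u)) := by
  have h : Function.uncurry (Dt u) =
      fun z : ℝ × ℝ => fderiv ℝ (Function.uncurry u) z ((1 : ℝ), (0 : ℝ)) := by
    funext ⟨t, x⟩
    have h1 := ((hu.differentiable (by simp)) (t, x)).hasFDerivAt.comp_hasDerivAt t
      ((hasDerivAt_id t).prodMk (hasDerivAt_const t x))
    exact (hasDerivAt_Dt hu t x).unique h1
  rw [h]
  exact (hu.fderiv_right (m := (⊤ : ℕ∞)) (by simp)).clm_apply contDiff_const

theorem contDiff_Dx {u : ℝ → ℝ → ℝ} (hu : ContDiff ℝ (⊤ : ℕ∞) (Function.uncurry u)) :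
    ContDiff ℝ (⊤ : ℕ∞) (Function.uncurry (Dx u)) := by
  have h : Function.uncurry (Dx u) =
      fun z : ℝ × ℝ => fderiv ℝ (Function.uncurry u) z ((0 : ℝ), (1 : ℝ)) := by
    funext ⟨t, x⟩
    have h1 := ((hu.differentiable (by simp)) (t, x)).hasFDerivAt.comp_hasDerivAt x
      ((hasDerivAt_const x t).prodMk (hasDerivAt_id x))
    exact (hasDerivAt_Dx hu t x).unique h1
  rw [h]
  exact (hu.fderiv_right (m := (⊤ : ℕ∞)) (by simp)).clm_apply contDiff_const

theorem continuous_slice {u : ℝ → ℝ → ℝ} (hu : Continuous (Function.uncurry u)) (t : ℝ) :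
    Continuous (u t) :=
  hu.comp (by fun_prop : Continuous fun x : ℝ => (t, x))

/-- Differentiation under the integral sign over `[0, 1]`, for a jointly continuous derivative. -/
theorem hasDerivAt_integral_of_continuous {F F' : ℝ → ℝ → ℝ}
    (hF : Continuous (Function.uncurry F)) (hF' : Continuous (Function.uncurry F'))
    (hd : ∀ t x, HasDerivAt (fun s => F s x) (F' t x) t) (t : ℝ) :
    HasDerivAt (fun s => ∫ x in (0:ℝ)..1, F s x) (∫ x in (0:ℝ)..1, F' t x) t := by
  obtain ⟨C, hC⟩ := ((isCompact_Icc (a := t - 1) (b := t + 1)).prod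
    (isCompact_Icc (a := (0:ℝ)) (b := 1))).exists_bound_of_continuousOn hF'.continuousOn
  refine (intervalIntegral.hasDerivAt_integral_of_dominated_loc_of_deriv_le
    (F := F) (F' := F') (bound := fun _ => C) (μ := volume)
    (Icc_mem_nhds (by linarith : t - 1 < t) (by linarith : t < t + 1))
    (Filter.Eventually.of_forall fun s => (continuous_slice hF s).aestronglyMeasurable)
    ((continuous_slice hF t).intervalIntegrable _ _)
    (continuous_slice hF' t).aestronglyMeasurable
    (Filter.Eventually.of_forall fun x hx s hs => ?_)
    intervalIntegrable_const
    (Filter.Eventually.of_forall fun x _ s _ => hd s x)).2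
  rw [Set.uIoc_of_le zero_le_one] at hx
  exact hC (s, x) ⟨hs, hx.1.le, hx.2⟩

/-! ### Sharp Poincaré inequalities on `[0, 1]` -/

theorem integral_mul_deriv_of_zero {v w v' w' : ℝ → ℝ}
    (hv : ∀ x, HasDerivAt v (v' x) x) (hw : ∀ x, HasDerivAt w (w' x) x)
    (cv : Continuous v') (cw : Continuous w') (h0 : v 0 * w 0 = 0) (h1 : v 1 * w 1 = 0) :
    ipL2 v w' = -ipL2 v' w := by
  have h := intervalIntegral.integral_mul_deriv_eq_deriv_mul (a := 0) (b := 1)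
    (fun x _ => hv x) (fun x _ => hw x) (cv.intervalIntegrable _ _) (cw.intervalIntegrable _ _)
  unfold ipL2
  rw [h, h0, h1]
  ring

theorem mul_nsqL2_le_of_lt_pi {v v' : ℝ → ℝ} (hv : ∀ x, HasDerivAt v (v' x) x)
    (cv : Continuous v') (h0 : v 0 = 0) (h1 : v 1 = 0) {l : ℝ} (hl0 : 0 < l) (hl : l < π) :
    l ^ 2 * nsqL2 v ≤ nsqL2 v' := by
  have cv0 : Continuous v := continuous_iff_continuousAt.2 fun x => (hv x).continuousAt
  let g : ℝ → ℝ := fun x => l * tan (l * (x - 1 / 2))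
  have hg : ∀ x ∈ Set.uIcc (0:ℝ) 1, HasDerivAt g (l ^ 2 + g x ^ 2) x := by
    intro x hx
    rw [Set.uIcc_of_le zero_le_one] at hx
    have hc : cos (l * (x - 1 / 2)) ≠ 0 := by
      apply (cos_pos_of_mem_Ioo ⟨?_, ?_⟩).ne'
      · nlinarith [hx.1]
      · nlinarith [hx.2]
    have hin : HasDerivAt (fun x : ℝ => l * (x - 1 / 2)) (l * 1) x :=
      ((hasDerivAt_id x).sub_const _).const_mul l
    have h := ((hasDerivAt_tan hc).comp x hin).const_mul l
    refine h.congr_deriv ?_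
    simp only [g]
    generalize l * (x - 1 / 2) = y at hc
    rw [tan_eq_sin_div_cos]
    field_simp
    linear_combination -sin_sq_add_cos_sq y
  have cg : ContinuousOn g (Set.uIcc 0 1) := fun x hx => (hg x hx).continuousAt.continuousWithinAt
  have hder : ∀ x ∈ Set.uIcc (0:ℝ) 1, HasDerivAt (fun x => g x * v x ^ 2)
      ((l ^ 2 + g x ^ 2) * v x ^ 2 + g x * (2 * v x * v' x)) x := by
    intro x hx
    refine ((hg x hx).mul ((hv x).pow 2)).congr_deriv ?_
    simp
  have hint : IntervalIntegrable
      (fun x => (l ^ 2 + g x ^ 2) * v x ^ 2 + g x * (2 * v x * v' x)) volume 0 1 :=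
    ContinuousOn.intervalIntegrable (by fun_prop)
  have hftc := intervalIntegral.integral_eq_sub_of_hasDerivAt hder hint
  simp only [h0, h1, ne_eq, OfNat.ofNat_ne_zero, not_false_eq_true, zero_pow, mul_zero,
    sub_zero] at hftc
  have hpos : 0 ≤ ∫ x in (0:ℝ)..1, (v' x + g x * v x) ^ 2 :=
    intervalIntegral.integral_nonneg zero_le_one fun x _ => sq_nonneg _
  have hsplit : ∫ x in (0:ℝ)..1, (v' x + g x * v x) ^ 2 =
      nsqL2 v' - l ^ 2 * nsqL2 v +
        ∫ x in (0:ℝ)..1, ((l ^ 2 + g x ^ 2) * v x ^ 2 + g x * (2 * v x * v' x)) := by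
    unfold nsqL2
    rw [← intervalIntegral.integral_const_mul, ← intervalIntegral.integral_sub,
      ← intervalIntegral.integral_add _ hint]
    · congr 1
      funext x
      ring
    all_goals exact Continuous.intervalIntegrable (by fun_prop) _ _
  linarith

/-- The sharp Poincaré (Wirtinger) inequality for functions vanishing at `0` and `1`. -/
theorem pi_sq_mul_nsqL2_le {v v' : ℝ → ℝ} (hv : ∀ x, HasDerivAt v (v' x) x)
    (cv : Continuous v') (h0 : v 0 = 0) (h1 : v 1 = 0) : π ^ 2 * nsqL2 v ≤ nsqL2 v' := by
  have hlim : Filter.Tendsto (fun l : ℝ => l ^ 2 * nsqL2 v) (nhdsWithin π (Set.Iio π))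
      (nhds (π ^ 2 * nsqL2 v)) :=
    ((by fun_prop : Continuous fun l : ℝ => l ^ 2 * nsqL2 v).tendsto π).mono_left
      nhdsWithin_le_nhds
  refine le_of_tendsto hlim ?_
  filter_upwards [Ioo_mem_nhdsLT pi_pos] with l hl
  exact mul_nsqL2_le_of_lt_pi hv cv h0 h1 hl.1 hl.2

theorem nsqL2_linear_comb {v w : ℝ → ℝ} (cv : Continuous v) (cw : Continuous w) (a b : ℝ) :
    nsqL2 (fun x => a * v x + b * w x) =
      a ^ 2 * nsqL2 v + 2 * a * b * ipL2 v w + b ^ 2 * nsqL2 w := by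
  unfold nsqL2 ipL2
  rw [← intervalIntegral.integral_const_mul, ← intervalIntegral.integral_const_mul,
    ← intervalIntegral.integral_const_mul, ← intervalIntegral.integral_add,
    ← intervalIntegral.integral_add]
  · congr 1
    funext x
    ring
  all_goals exact Continuous.intervalIntegrable (by fun_prop) _ _

theorem nsqL2_nonneg (v : ℝ → ℝ) : 0 ≤ nsqL2 v :=
  intervalIntegral.integral_nonneg zero_le_one fun _ _ => sq_nonneg _

/-- The bound by the first eigenvalue `π⁴` of `∂ₓₓₓₓ` with pinned boundary conditions. -/
theorem pi_pow_four_mul_nsqL2_le {v v' v'' : ℝ → ℝ} (hv : ∀ x, HasDerivAt v (v' x) x)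
    (hv' : ∀ x, HasDerivAt v' (v'' x) x) (cv' : Continuous v') (cv'' : Continuous v'')
    (h0 : v 0 = 0) (h1 : v 1 = 0) : π ^ 4 * nsqL2 v ≤ nsqL2 v'' := by
  have cv : Continuous v := continuous_iff_continuousAt.2 fun x => (hv x).continuousAt
  have hP := pi_sq_mul_nsqL2_le hv cv' h0 h1
  have hI : ipL2 v v'' = -ipL2 v' v' :=
    integral_mul_deriv_of_zero hv hv' cv' cv'' (by simp [h0]) (by simp [h1])
  have hN : ipL2 v' v' = nsqL2 v' := by simp only [ipL2, nsqL2, sq]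
  have h := nsqL2_nonneg (fun x => π ^ 2 * v x + 1 * v'' x)
  rw [nsqL2_linear_comb cv cv'', hI, hN] at h
  nlinarith [mul_le_mul_of_nonneg_left hP (sq_nonneg π)]

/-- Young's inequality `⟨u, v⟩ ≤ (c/2)‖u‖² + (1/(2c))‖v‖²`. -/
theorem ipL2_le_young {v w : ℝ → ℝ} (cv : Continuous v) (cw : Continuous w) {c : ℝ}
    (hc : 0 < c) : ipL2 v w ≤ c / 2 * nsqL2 v + 1 / (2 * c) * nsqL2 w := by
  have h := nsqL2_nonneg (fun x => c * v x + (-1) * w x)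
  rw [nsqL2_linear_comb cv cw] at h
  have h2 : 0 ≤ 1 / (2 * c) * (c ^ 2 * nsqL2 v + 2 * c * (-1) * ipL2 v w + (-1) ^ 2 * nsqL2 w) :=
    mul_nonneg (by positivity) h
  have h3 : 1 / (2 * c) * (c ^ 2 * nsqL2 v + 2 * c * (-1) * ipL2 v w + (-1) ^ 2 * nsqL2 w) =
      c / 2 * nsqL2 v + 1 / (2 * c) * nsqL2 w - ipL2 v w := by
    field_simp
    ring
  linarith

/-- The weak form of the bridge equation tested against the solution itself. -/
theorem IsClassicalSolution.ipL2_Dt_Dt {p k : ℝ} {f u : ℝ → ℝ → ℝ}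
    (hf : Continuous (Function.uncurry f)) (hu : IsClassicalSolution p k f u) {t : ℝ}
    (ht : 0 ≤ t) :
    ipL2 (u t) (Dt (Dt u) t) = ipL2 (u t) (f t) - nsqL2 (Dx (Dx u) t)
      + (p - nsqL2 (Dx u t)) * nsqL2 (Dx u t) - ipL2 (u t) (Dt u t)
      - k ^ 2 * nsqL2 (fun x => max (u t x) 0) := by
  obtain ⟨hs, heq, hbc⟩ := hu
  obtain ⟨b0, b1, c0, c1⟩ := hbc t ht
  have hx1 := contDiff_Dx hs
  have hx2 := contDiff_Dx hx1
  have hx3 := contDiff_Dx hx2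
  have hx4 := contDiff_Dx hx3
  have cu := continuous_slice hs.continuous t
  have cu1 := continuous_slice hx1.continuous t
  have cu2 := continuous_slice hx2.continuous t
  have cu3 := continuous_slice hx3.continuous t
  have cu4 := continuous_slice hx4.continuous t
  have cut := continuous_slice (contDiff_Dt hs).continuous t
  have cf := continuous_slice hf t
  have h4 : ipL2 (u t) (Dx (Dx (Dx (Dx u))) t) = nsqL2 (Dx (Dx u) t) := by
    rw [integral_mul_deriv_of_zero (hasDerivAt_Dx hs t) (hasDerivAt_Dx hx3 t) cu1 cu4
        (by simp [b0]) (by simp [b1]),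
      integral_mul_deriv_of_zero (hasDerivAt_Dx hx1 t) (hasDerivAt_Dx hx2 t) cu2 cu3
        (by simp [c0]) (by simp [c1]), neg_neg]
    simp only [ipL2, nsqL2, sq]
  have h2 : ipL2 (u t) (Dx (Dx u) t) = -nsqL2 (Dx u t) := by
    rw [integral_mul_deriv_of_zero (hasDerivAt_Dx hs t) (hasDerivAt_Dx hx1 t) cu1 cu2
        (by simp [b0]) (by simp [b1])]
    simp only [ipL2, nsqL2, sq]
  have hmain : ipL2 (u t) (Dt (Dt u) t) = ipL2 (u t) (f t)
      - ipL2 (u t) (Dx (Dx (Dx (Dx u))) t)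
      - (p - nsqL2 (Dx u t)) * ipL2 (u t) (Dx (Dx u) t) - ipL2 (u t) (Dt u t)
      - k ^ 2 * nsqL2 (fun x => max (u t x) 0) := by
    have heqt := heq t ht
    generalize nsqL2 (Dx u t) = N at heqt ⊢
    unfold ipL2 nsqL2
    rw [← intervalIntegral.integral_const_mul, ← intervalIntegral.integral_const_mul,
      ← intervalIntegral.integral_sub, ← intervalIntegral.integral_sub,
      ← intervalIntegral.integral_sub, ← intervalIntegral.integral_sub]
    · refine intervalIntegral.integral_congr fun x hx => ?_
      rw [Set.uIcc_of_le zero_le_one] at hx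
      have hmax : max (u t x) 0 ^ 2 = u t x * max (u t x) 0 := by
        rcases le_total (u t x) 0 with h | h <;> simp [h, sq]
      simp only [hmax]
      linear_combination u t x * heqt x hx
    all_goals exact Continuous.intervalIntegrable (by fun_prop) _ _
  rw [hmain, h4, h2]
  ring

/-- The differential inequality for `Υ(t) = ⟨u(t,·), ∂ₜu(t,·)⟩`: for every `t > 0`, `Υ`
is differentiable at `t` and
`Υ'(t) + Υ(t) + ½E(t) ≤ (3/2)‖∂ₜu(t,·)‖² + (1/(2π⁴))‖f(t,·)‖² + ½p²`. -/
theorem upsilon_inequality (p k : ℝ) (f u : ℝ → ℝ → ℝ)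
    (hf : Continuous (Function.uncurry f))
    (hu : IsClassicalSolution p k f u) :
    ∀ t > (0:ℝ), DifferentiableAt ℝ (fun s => ipL2 (u s) (Dt u s)) t ∧
      deriv (fun s => ipL2 (u s) (Dt u s)) t + ipL2 (u t) (Dt u t)
          + (1 / 2) * energy p k u t
        ≤ (3 / 2) * nsqL2 (Dt u t) + (1 / (2 * π ^ 4)) * nsqL2 (f t)
          + (1 / 2) * p ^ 2 := by
  intro t ht
  have hs := hu.1
  have hst := contDiff_Dt hs
  have hstt := contDiff_Dt hst
  have hx1 := contDiff_Dx hs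
  have cu := continuous_slice hs.continuous t
  have cut := continuous_slice hst.continuous t
  have cutt := continuous_slice hstt.continuous t
  have hderiv : HasDerivAt (fun s => ipL2 (u s) (Dt u s))
      (nsqL2 (Dt u t) + ipL2 (u t) (Dt (Dt u) t)) t := by
    have h := hasDerivAt_integral_of_continuous
      (F := fun s x => u s x * Dt u s x)
      (F' := fun s x => Dt u s x * Dt u s x + u s x * Dt (Dt u) s x)
      (hs.continuous.mul hst.continuous)
      ((hst.continuous.mul hst.continuous).add (hs.continuous.mul hstt.continuous))
      (fun s x => (hasDerivAt_Dt hs s x).mul (hasDerivAt_Dt hst s x)) t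
    refine h.congr_deriv ?_
    rw [intervalIntegral.integral_add (Continuous.intervalIntegrable (by fun_prop) _ _)
      (Continuous.intervalIntegrable (by fun_prop) _ _)]
    simp only [ipL2, nsqL2, sq]
  refine ⟨hderiv.differentiableAt, ?_⟩
  obtain ⟨b0, b1, -, -⟩ := hu.2.2 t ht.le
  have hpoinc := pi_pow_four_mul_nsqL2_le (hasDerivAt_Dx hs t) (hasDerivAt_Dx hx1 t)
    (continuous_slice hx1.continuous t) (continuous_slice (contDiff_Dx hx1).continuous t) b0 b1
  have hyoung := ipL2_le_young cu (continuous_slice hf t) (c := π ^ 4) (by positivity)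
  have hk : 0 ≤ k ^ 2 * nsqL2 (fun x => max (u t x) 0) :=
    mul_nonneg (sq_nonneg k) (nsqL2_nonneg _)
  rw [hderiv.deriv, hu.ipL2_Dt_Dt hf ht.le]
  unfold energy
  nlinarith [sq_nonneg (nsqL2 (Dx u t) - p / 3), sq_nonneg p]
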